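/- Let ψ₁ be a Schwartz function on ℝ with 0 ≤ ψ₁ ≤ 1 and support a compact subset of (0,1), let ψ(y) = ψ₁(y) − ψ₁(−y), and let Ψ(x,ξ₁,ξ₂,ξ₃) = ψ(x)ψ(ξ₂)ψ(ξ₃)ψ(ξ₁−ξ₂−2ξ₃). Let σ_TH(x,ξ₁,ξ₂,ξ₃) = πi·sign(ξ₁−ξ₂−2ξ₃). Then for every r > 1, σ_TH belongs to 𝓜^{(∞,1,r,r);(∞,∞,∞,1)} with window Ψ; that is, ∫_ℝ sup_{ξ₁,ξ₂,ξ₃∈ℝ} (∫_ℝ (∫_ℝ (∫_ℝ sup_{x∈ℝ} |𝒱_Ψ σ_TH(x,t₁,t₂,t₃,ξ₁,ξ₂,ξ₃,ν)| dt₁)^{r} dt₂)^{r/r} dt₃)^{1/r} dν < ∞. -/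

import Mathlib

open MeasureTheory Complex
open scoped ENNReal NNReal

noncomputable section

/-- `e2pi a = e^{2πi a}`. -/
def e2pi (a : ℝ) : ℂ := Complex.exp (2 * Real.pi * Complex.I * (a : ℂ))

/-- Short-time Fourier transform on `ℝ`: `V_φ f (t, ν)`. -/
def STFT1 (φ f : ℝ → ℂ) (t ν : ℝ) : ℂ := ∫ y : ℝ, f y * e2pi (-(y * ν)) * φ (y - t)

/-- The Gaussian window `e^{-x²}` on `ℝ`. -/
def gauss1 : ℝ → ℂ := fun x => (Real.exp (-x ^ 2) : ℝ)

/-- `L^p`-type norm (`ℝ≥0∞`-valued) with essential supremum in case `p = ∞`. -/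
def eNorm {α : Type*} [MeasurableSpace α] (μ : Measure α) (p : ℝ≥0∞) (F : α → ℝ≥0∞) : ℝ≥0∞ :=
  if p = ∞ then essSup F μ else (∫⁻ a, F a ^ p.toReal ∂μ) ^ (1 / p.toReal)

/-- Modulation space norm `‖f‖_{M^{p,q}}` on `ℝ` with the Gaussian window. -/
def modNorm1 (p q : ℝ≥0∞) (f : ℝ → ℂ) : ℝ≥0∞ :=
  eNorm volume q fun ν => eNorm volume p fun t => (‖STFT1 gauss1 f t ν‖₊ : ℝ≥0∞)

/-- Fourier transform on `ℝ`. -/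
def FT1 (f : ℝ → ℂ) (ξ : ℝ) : ℂ := ∫ y : ℝ, f y * e2pi (-(y * ξ))

/-- Symbol short-time Fourier transform of a symbol on `ℝ³`. -/
def symbSTFT3 (Ψ σ : ℝ × ℝ × ℝ → ℂ) (x t₁ t₂ ξ₁ ξ₂ ν : ℝ) : ℂ :=
  ∫ X : ℝ × ℝ × ℝ, σ X * Ψ (X.1 - x, X.2.1 - ξ₁, X.2.2 - ξ₂) *
    e2pi (-(X.1 * ν - t₁ * X.2.1 - t₂ * X.2.2))

/-- Symbol short-time Fourier transform of a symbol on `ℝ⁴`. -/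
def symbSTFT4 (Ψ σ : ℝ × ℝ × ℝ × ℝ → ℂ) (x t₁ t₂ t₃ ξ₁ ξ₂ ξ₃ ν : ℝ) : ℂ :=
  ∫ X : ℝ × ℝ × ℝ × ℝ, σ X * Ψ (X.1 - x, X.2.1 - ξ₁, X.2.2.1 - ξ₂, X.2.2.2 - ξ₃) *
    e2pi (-(X.1 * ν - t₁ * X.2.1 - t₂ * X.2.2.1 - t₃ * X.2.2.2))

/-- The bilinear Hilbert transform as an (absolutely convergent) bilinear Fourier
multiplier for Schwartz functions. -/
def BH (f g : ℝ → ℂ) (x : ℝ) : ℂ :=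
  ∫ ξ : ℝ × ℝ, (-(Real.pi : ℂ) * Complex.I * (Real.sign (ξ.1 - ξ.2) : ℝ)) *
    FT1 f ξ.1 * FT1 g ξ.2 * e2pi (x * (ξ.1 + ξ.2))

/-- The trilinear Hilbert transform as an (absolutely convergent) trilinear Fourier
multiplier for Schwartz functions. -/
def TH (f g h : ℝ → ℂ) (x : ℝ) : ℂ :=
  ∫ ξ : ℝ × ℝ × ℝ, ((Real.pi : ℂ) * Complex.I * (Real.sign (ξ.1 - ξ.2.1 - 2 * ξ.2.2) : ℝ)) *
    FT1 f ξ.1 * FT1 g ξ.2.1 * FT1 h ξ.2.2 * e2pi (x * (ξ.1 + ξ.2.1 + ξ.2.2))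

lemma e2pi_add (a b : ℝ) : e2pi (a + b) = e2pi a * e2pi b := by
  unfold e2pi
  rw [← Complex.exp_add]
  push_cast
  ring_nf

lemma norm_e2pi (a : ℝ) : ‖e2pi a‖ = 1 := by
  unfold e2pi
  rw [show 2 * (Real.pi : ℂ) * I * (a : ℂ) = ((2 * Real.pi * a : ℝ) : ℂ) * I by push_cast; ring]
  exact Complex.norm_exp_ofReal_mul_I _

lemma continuous_e2pi : Continuous e2pi := by
  unfold e2pi
  fun_prop

lemma hasDerivAt_e2pi_mul (t c : ℝ) :
    HasDerivAt (fun c : ℝ => e2pi (t * c)) (2 * Real.pi * I * t * e2pi (t * c)) c := by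
  unfold e2pi
  have h : HasDerivAt (fun c : ℝ => 2 * (Real.pi : ℂ) * I * ((t * c : ℝ) : ℂ))
      (2 * Real.pi * I * t) c := by
    have h₁ : HasDerivAt (fun c : ℝ => ((t * c : ℝ) : ℂ)) (t : ℂ) c := by
      simpa using ((hasDerivAt_id c).const_mul t).ofReal_comp
    exact h₁.const_mul _
  convert! h.cexp using 1
  ring

lemma SchwartzMap.exists_norm_le_mul_inv_pow (f : SchwartzMap ℝ ℂ) (k : ℕ) :
    ∃ C : ℝ, 0 ≤ C ∧ ∀ u, ‖f u‖ ≤ C * ((1 + |u|)⁻¹) ^ k := by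
  refine ⟨2 ^ k * (Finset.Iic (k, 0)).sup (fun m => SchwartzMap.seminorm ℝ m.1 m.2) f,
    by positivity, fun u => ?_⟩
  have h := SchwartzMap.one_add_le_sup_seminorm_apply (𝕜 := ℝ) (m := (k, 0)) le_rfl le_rfl f u
  simp only [norm_iteratedFDeriv_zero, Real.norm_eq_abs] at h
  rw [inv_pow, ← div_eq_mul_inv, le_div_iff₀ (by positivity), mul_comm]
  exact h

lemma FT1_eq_fourier (f : SchwartzMap ℝ ℂ) (u : ℝ) :
    FT1 f u = (FourierTransform.fourier f : SchwartzMap ℝ ℂ) u := by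
  rw [SchwartzMap.fourier_coe, Real.fourier_real_eq_integral_exp_smul]
  unfold FT1 e2pi
  congr 1
  ext y
  rw [smul_eq_mul, mul_comm]
  congr 2
  push_cast
  ring

lemma norm_integral_sign_mul_le (f : ℝ → ℂ) (s A : ℝ)
    (hf : Integrable f)
    (hIoi : ‖∫ c in Set.Ioi (-s), f c‖ ≤ A) (hIic : ‖∫ c in Set.Iic (-s), f c‖ ≤ A) :
    ‖∫ c : ℝ, ((Real.sign (c + s) : ℝ) : ℂ) * f c‖ ≤ 2 * A := by
  have hsign : Measurable fun c : ℝ => ((Real.sign (c + s) : ℝ) : ℂ) := by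
    refine Complex.measurable_ofReal.comp (Measurable.comp (g := Real.sign) ?_ (by fun_prop))
    unfold Real.sign
    exact Measurable.ite measurableSet_Iio measurable_const
      (Measurable.ite measurableSet_Ioi measurable_const measurable_const)
  have hint : Integrable fun c : ℝ => ((Real.sign (c + s) : ℝ) : ℂ) * f c := by
    refine hf.bdd_mul hsign.aestronglyMeasurable (c := 1) (Filter.Eventually.of_forall fun c => ?_)
    rcases Real.sign_apply_eq (c + s) with h | h | h <;> simp [h]
  rw [← integral_add_compl (measurableSet_Iic (a := -s)) hint, Set.compl_Iic,
    integral_Iic_eq_integral_Iio]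
  have h₁ : ∫ c in Set.Iio (-s), ((Real.sign (c + s) : ℝ) : ℂ) * f c =
      -∫ c in Set.Iic (-s), f c := by
    rw [integral_Iic_eq_integral_Iio, ← integral_neg]
    refine setIntegral_congr_fun measurableSet_Iio fun c hc => ?_
    simp only [Set.mem_Iio] at hc
    simp [Real.sign_of_neg (show c + s < 0 by linarith)]
  have h₂ : ∫ c in Set.Ioi (-s), ((Real.sign (c + s) : ℝ) : ℂ) * f c =
      ∫ c in Set.Ioi (-s), f c := by
    refine setIntegral_congr_fun measurableSet_Ioi fun c hc => ?_
    simp only [Set.mem_Ioi] at hc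
    simp [Real.sign_of_pos (show 0 < c + s by linarith)]
  rw [h₁, h₂]
  refine (norm_add_le _ _).trans ?_
  rw [norm_neg]
  linarith

/-- The Fourier transform of a Schwartz function with a sign jump at an arbitrary point decays
like `1 / (1 + |t|)`, uniformly in the position of the jump. -/
lemma exists_norm_integral_sign_mul_e2pi_le (f : SchwartzMap ℝ ℂ) :
    ∃ B : ℝ, 0 ≤ B ∧ ∀ s t : ℝ,
      ‖∫ c : ℝ, ((Real.sign (c + s) : ℝ) : ℂ) * (f c * e2pi (t * c))‖ ≤ B * (1 + |t|)⁻¹ := by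
  obtain ⟨M, hM0, hM⟩ := f.exists_norm_le_mul_inv_pow 0
  replace hM : ∀ u, ‖f u‖ ≤ M := by simpa using hM
  set f' : SchwartzMap ℝ ℂ := SchwartzMap.derivCLM ℝ ℂ f with hf'
  have hder : ∀ c, HasDerivAt f (f' c) c := fun c => by
    rw [hf', SchwartzMap.derivCLM_apply]
    exact f.differentiableAt.hasDerivAt
  have he : ∀ t : ℝ, Continuous fun c : ℝ => e2pi (t * c) := fun t =>
    continuous_e2pi.comp (by fun_prop)
  have hint : ∀ (h : SchwartzMap ℝ ℂ) (t : ℝ), Integrable fun c => h c * e2pi (t * c) :=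
    fun h t => h.integrable.mul_bdd (c := 1) (he t).aestronglyMeasurable
      (Filter.Eventually.of_forall fun c => (norm_e2pi _).le)
  have hnorm : ∀ (h : SchwartzMap ℝ ℂ) (t : ℝ) (S : Set ℝ),
      ‖∫ c in S, h c * e2pi (t * c)‖ ≤ ∫ c, ‖h c‖ := fun h t S => by
    refine (norm_integral_le_integral_norm _).trans ?_
    simp only [norm_mul, norm_e2pi, mul_one]
    exact setIntegral_le_integral h.integrable.norm
      (Filter.Eventually.of_forall fun c => norm_nonneg _)
  set L := ∫ c, ‖f c‖
  set L' := ∫ c, ‖f' c‖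
  have hL : 0 ≤ L := integral_nonneg fun _ => norm_nonneg _
  have hL' : 0 ≤ L' := integral_nonneg fun _ => norm_nonneg _
  have hprod : ∀ t c : ℝ, HasDerivAt (fun c => f c * e2pi (t * c))
      (2 * Real.pi * I * t * (f c * e2pi (t * c)) + f' c * e2pi (t * c)) c := fun t c => by
    convert! (hder c).mul (hasDerivAt_e2pi_mul t c) using 1
    ring
  have hprodint : ∀ t : ℝ, Integrable fun c =>
      2 * Real.pi * I * t * (f c * e2pi (t * c)) + f' c * e2pi (t * c) := fun t =>
    ((hint f t).const_mul _).add (hint f' t)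
  have htend : ∀ t : ℝ, Filter.Tendsto (fun c => f c * e2pi (t * c))
      (Filter.cocompact ℝ) (nhds 0) := fun t => by
    rw [tendsto_zero_iff_norm_tendsto_zero]
    simp only [norm_mul, norm_e2pi, mul_one]
    exact f.tendsto_cocompact.norm.trans_eq (by simp)
  have hend : ∀ t a : ℝ, ‖f a * e2pi (t * a)‖ ≤ M := fun t a => by
    simpa [norm_e2pi] using hM a
  have hkey : ∀ (t : ℝ) (S : Set ℝ),
      ‖∫ c in S, (2 * Real.pi * I * t * (f c * e2pi (t * c)) + f' c * e2pi (t * c))‖ ≤ M →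
      ‖∫ c in S, f c * e2pi (t * c)‖ ≤ (L + M + L') * (1 + |t|)⁻¹ := fun t S h => by
    rw [integral_add ((hint f t).const_mul _).integrableOn (hint f' t).integrableOn,
      integral_const_mul] at h
    have h₁ := norm_sub_norm_le (2 * (Real.pi : ℂ) * I * t * ∫ c in S, f c * e2pi (t * c))
      (-∫ c in S, f' c * e2pi (t * c))
    rw [sub_neg_eq_add, norm_neg, norm_mul] at h₁
    have h₂ : ‖2 * (Real.pi : ℂ) * I * t‖ = 2 * Real.pi * |t| := by
      simp [abs_of_pos Real.pi_pos]
    rw [h₂] at h₁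
    have h₃ := hnorm f' t S
    have h₄ := hnorm f t S
    set X := ‖∫ c in S, f c * e2pi (t * c)‖
    have hX : 0 ≤ X := norm_nonneg _
    have h₅ : |t| * X ≤ 2 * Real.pi * |t| * X := by
      have := Real.pi_gt_three
      have := mul_nonneg (abs_nonneg t) hX
      nlinarith
    rw [← div_eq_mul_inv, le_div_iff₀ (by positivity)]
    linarith
  refine ⟨2 * (L + M + L'), by positivity, fun s t => ?_⟩
  rw [mul_assoc]
  refine norm_integral_sign_mul_le _ s _ (hint f t) (hkey t _ ?_) (hkey t _ ?_)
  · rw [integral_Ioi_of_hasDerivAt_of_tendsto' (fun c _ => hprod t c) (hprodint t).integrableOn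
      ((htend t).mono_left _root_.atTop_le_cocompact), zero_sub, norm_neg]
    exact hend t _
  · rw [integral_Iic_of_hasDerivAt_of_tendsto' (fun c _ => hprod t c) (hprodint t).integrableOn
      ((htend t).mono_left _root_.atBot_le_cocompact), sub_zero]
    exact hend t _

/-- Integration over `ℝ⁴` in the translated and sheared coordinates adapted to the form
`ξ₁ - ξ₂ - 2 ξ₃`. -/
lemma integral_comp_shear (x ξ₁ ξ₂ ξ₃ : ℝ) (F : ℝ × ℝ × ℝ × ℝ → ℂ) :
    ∫ Y : ℝ × ℝ × ℝ × ℝ, F (Y.1 + x, Y.2.1 + (Y.2.2.1 + 2 * Y.2.2.2 + ξ₁),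
      Y.2.2.1 + ξ₂, Y.2.2.2 + ξ₃) = ∫ X, F X := by
  have hz : MeasurePreserving (fun z : ℝ × ℝ => (z.1 + ξ₂, z.2 + ξ₃)) :=
    (measurePreserving_add_right volume ξ₂).prod (measurePreserving_add_right volume ξ₃)
  have hskew : MeasurePreserving (fun p : (ℝ × ℝ) × ℝ =>
      ((p.1.1 + ξ₂, p.1.2 + ξ₃), p.2 + (p.1.1 + 2 * p.1.2 + ξ₁))) :=
    hz.skew_product (g := fun z c => c + (z.1 + 2 * z.2 + ξ₁)) (by fun_prop)
      (Filter.Eventually.of_forall fun z => (measurePreserving_add_right volume _).map_eq)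
  have h₃ : MeasurePreserving (fun p : ℝ × ℝ × ℝ =>
      (p.1 + (p.2.1 + 2 * p.2.2 + ξ₁), p.2.1 + ξ₂, p.2.2 + ξ₃)) :=
    (Measure.measurePreserving_swap.comp hskew).comp Measure.measurePreserving_swap
  have h₄ : MeasurePreserving (fun Y : ℝ × ℝ × ℝ × ℝ =>
      (Y.1 + x, Y.2.1 + (Y.2.2.1 + 2 * Y.2.2.2 + ξ₁), Y.2.2.1 + ξ₂, Y.2.2.2 + ξ₃)) :=
    (measurePreserving_add_right volume x).prod h₃
  let e : (ℝ × ℝ × ℝ × ℝ) ≃ᵐ (ℝ × ℝ × ℝ × ℝ) :=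
    { toFun := fun Y => (Y.1 + x, Y.2.1 + (Y.2.2.1 + 2 * Y.2.2.2 + ξ₁), Y.2.2.1 + ξ₂, Y.2.2.2 + ξ₃)
      invFun := fun X => (X.1 - x, X.2.1 - ((X.2.2.1 - ξ₂) + 2 * (X.2.2.2 - ξ₃) + ξ₁),
        X.2.2.1 - ξ₂, X.2.2.2 - ξ₃)
      left_inv := fun Y => by simp
      right_inv := fun X => by simp
      measurable_toFun := by dsimp; fun_prop
      measurable_invFun := by dsimp; fun_prop }
  exact h₄.integral_comp e.measurableEmbedding F

lemma norm_symbSTFT4_sign_form (ψ : ℝ → ℂ) (x t₁ t₂ t₃ ξ₁ ξ₂ ξ₃ ν : ℝ) :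
    ‖symbSTFT4
      (fun X => ψ X.1 * ψ X.2.2.1 * ψ X.2.2.2 * ψ (X.2.1 - X.2.2.1 - 2 * X.2.2.2))
      (fun X => (Real.pi : ℂ) * I * (Real.sign (X.2.1 - X.2.2.1 - 2 * X.2.2.2) : ℝ))
      x t₁ t₂ t₃ ξ₁ ξ₂ ξ₃ ν‖ =
    Real.pi * (‖FT1 ψ ν‖ *
      (‖∫ c : ℝ, ((Real.sign (c + (ξ₁ - ξ₂ - 2 * ξ₃)) : ℝ) : ℂ) * (ψ c * e2pi (t₁ * c))‖ *
        (‖FT1 ψ (-(t₁ + t₂))‖ * ‖FT1 ψ (-(2 * t₁ + t₃))‖))) := by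
  unfold symbSTFT4
  rw [← integral_comp_shear x ξ₁ ξ₂ ξ₃]
  set s := ξ₁ - ξ₂ - 2 * ξ₃ with hs
  set κ : ℂ := Real.pi * I * e2pi (-(x * ν - t₁ * ξ₁ - t₂ * ξ₂ - t₃ * ξ₃)) with hκ
  have hκn : ‖κ‖ = Real.pi := by simp [hκ, norm_e2pi, abs_of_pos Real.pi_pos]
  have hfun : ∀ Y : ℝ × ℝ × ℝ × ℝ,
      (Real.pi : ℂ) * I * (Real.sign (Y.2.1 + (Y.2.2.1 + 2 * Y.2.2.2 + ξ₁) - (Y.2.2.1 + ξ₂) -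
        2 * (Y.2.2.2 + ξ₃)) : ℝ) *
      (ψ (Y.1 + x - x) * ψ (Y.2.2.1 + ξ₂ - ξ₂) * ψ (Y.2.2.2 + ξ₃ - ξ₃) *
        ψ (Y.2.1 + (Y.2.2.1 + 2 * Y.2.2.2 + ξ₁) - ξ₁ - (Y.2.2.1 + ξ₂ - ξ₂) -
          2 * (Y.2.2.2 + ξ₃ - ξ₃))) *
      e2pi (-((Y.1 + x) * ν - t₁ * (Y.2.1 + (Y.2.2.1 + 2 * Y.2.2.2 + ξ₁)) -
        t₂ * (Y.2.2.1 + ξ₂) - t₃ * (Y.2.2.2 + ξ₃))) =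
      κ * ((ψ Y.1 * e2pi (-(Y.1 * ν))) *
        ((((Real.sign (Y.2.1 + s) : ℝ) : ℂ) * (ψ Y.2.1 * e2pi (t₁ * Y.2.1))) *
          ((ψ Y.2.2.1 * e2pi (-(Y.2.2.1 * -(t₁ + t₂)))) *
            (ψ Y.2.2.2 * e2pi (-(Y.2.2.2 * -(2 * t₁ + t₃))))))) := fun Y => by
    have h₁ : Y.2.1 + (Y.2.2.1 + 2 * Y.2.2.2 + ξ₁) - (Y.2.2.1 + ξ₂) - 2 * (Y.2.2.2 + ξ₃) =
        Y.2.1 + s := by rw [hs]; ring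
    have h₂ : Y.2.1 + (Y.2.2.1 + 2 * Y.2.2.2 + ξ₁) - ξ₁ - (Y.2.2.1 + ξ₂ - ξ₂) -
        2 * (Y.2.2.2 + ξ₃ - ξ₃) = Y.2.1 := by ring
    have h₃ : -((Y.1 + x) * ν - t₁ * (Y.2.1 + (Y.2.2.1 + 2 * Y.2.2.2 + ξ₁)) -
        t₂ * (Y.2.2.1 + ξ₂) - t₃ * (Y.2.2.2 + ξ₃)) =
        -(x * ν - t₁ * ξ₁ - t₂ * ξ₂ - t₃ * ξ₃) + -(Y.1 * ν) + t₁ * Y.2.1 +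
          -(Y.2.2.1 * -(t₁ + t₂)) + -(Y.2.2.2 * -(2 * t₁ + t₃)) := by ring
    rw [h₁, h₂, h₃]
    simp only [e2pi_add, add_sub_cancel_right, hκ]
    ring
  simp only [hfun]
  rw [integral_const_mul, norm_mul, hκn]
  simp only [Measure.volume_eq_prod]
  rw [integral_prod_mul (fun y => ψ y * e2pi (-(y * ν)))
      (fun z : ℝ × ℝ × ℝ => (((Real.sign (z.1 + s) : ℝ) : ℂ) * (ψ z.1 * e2pi (t₁ * z.1))) *
          ((ψ z.2.1 * e2pi (-(z.2.1 * -(t₁ + t₂)))) *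
            (ψ z.2.2 * e2pi (-(z.2.2 * -(2 * t₁ + t₃)))))),
    integral_prod_mul (fun c => ((Real.sign (c + s) : ℝ) : ℂ) * (ψ c * e2pi (t₁ * c)))
      (fun z : ℝ × ℝ => (ψ z.1 * e2pi (-(z.1 * -(t₁ + t₂)))) *
            (ψ z.2 * e2pi (-(z.2 * -(2 * t₁ + t₃))))),
    integral_prod_mul (fun a => ψ a * e2pi (-(a * -(t₁ + t₂))))
      (fun b => ψ b * e2pi (-(b * -(2 * t₁ + t₃))))]
  simp only [norm_mul, FT1]

lemma inv_one_add_abs_mul_le (t₁ t₂ t₃ : ℝ) :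
    (1 + |t₁|)⁻¹ * (((1 + |t₁ + t₂|)⁻¹) ^ 4 * ((1 + |2 * t₁ + t₃|)⁻¹) ^ 4) ≤
      2 * ((1 + |t₂|)⁻¹ * (1 + |2 * t₂ - t₃|)⁻¹ * ((1 + |t₂ + t₁|)⁻¹) ^ 2) := by
  rw [add_comm t₂ t₁]
  have hp : ∀ u : ℝ, 0 < (1 + |u|)⁻¹ := fun u => by positivity
  have h₁ : (1 + |t₁|)⁻¹ * (1 + |t₁ + t₂|)⁻¹ ≤ (1 + |t₂|)⁻¹ := by
    rw [← mul_inv]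
    refine inv_anti₀ (by positivity) ?_
    have : |t₂| ≤ |t₁ + t₂| + |t₁| := by simpa using abs_sub (t₁ + t₂) t₁
    nlinarith [abs_nonneg t₁, abs_nonneg (t₁ + t₂), mul_nonneg (abs_nonneg t₁) (abs_nonneg (t₁ + t₂))]
  have h₂ : (1 + |t₁ + t₂|)⁻¹ * (1 + |2 * t₁ + t₃|)⁻¹ ≤ 2 * (1 + |2 * t₂ - t₃|)⁻¹ := by
    rw [← mul_inv, ← div_eq_mul_inv, le_div_iff₀ (by positivity), inv_mul_le_iff₀ (by positivity)]
    have : |2 * t₂ - t₃| ≤ 2 * |t₁ + t₂| + |2 * t₁ + t₃| := by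
      have h := abs_sub (2 * (t₁ + t₂)) (2 * t₁ + t₃)
      rwa [abs_mul, abs_two, show 2 * (t₁ + t₂) - (2 * t₁ + t₃) = 2 * t₂ - t₃ by ring] at h
    nlinarith [abs_nonneg (2 * t₁ + t₃), abs_nonneg (t₁ + t₂),
      mul_nonneg (abs_nonneg (2 * t₁ + t₃)) (abs_nonneg (t₁ + t₂))]
  have h₃ : ((1 + |2 * t₁ + t₃|)⁻¹) ^ 4 ≤ (1 + |2 * t₁ + t₃|)⁻¹ :=
    pow_le_of_le_one (hp _).le (inv_le_one_of_one_le₀ (by linarith [abs_nonneg (2 * t₁ + t₃)]))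
      (by norm_num)
  calc (1 + |t₁|)⁻¹ * (((1 + |t₁ + t₂|)⁻¹) ^ 4 * ((1 + |2 * t₁ + t₃|)⁻¹) ^ 4)
      ≤ (1 + |t₁|)⁻¹ * (((1 + |t₁ + t₂|)⁻¹) ^ 4 * (1 + |2 * t₁ + t₃|)⁻¹) := by gcongr
    _ = ((1 + |t₁|)⁻¹ * (1 + |t₁ + t₂|)⁻¹) * ((1 + |t₁ + t₂|)⁻¹ * (1 + |2 * t₁ + t₃|)⁻¹) *
          ((1 + |t₁ + t₂|)⁻¹) ^ 2 := by ring
    _ ≤ (1 + |t₂|)⁻¹ * (2 * (1 + |2 * t₂ - t₃|)⁻¹) * ((1 + |t₁ + t₂|)⁻¹) ^ 2 := by gcongr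
    _ = _ := by ring

lemma lintegral_inv_one_add_abs_rpow_lt_top {r : ℝ} (hr : 1 < r) :
    ∫⁻ u : ℝ, ENNReal.ofReal ((1 + |u|)⁻¹) ^ r < ∞ := by
  have h := finite_integral_one_add_norm (E := ℝ) (μ := volume) (r := r) (by simpa using hr)
  convert h using 3 with u
  rw [ENNReal.ofReal_rpow_of_nonneg (by positivity) (by linarith), Real.norm_eq_abs,
    Real.rpow_neg (by positivity), Real.inv_rpow (by positivity)]

/-- An iterated mixed norm of a function dominated by a sheared tensor product. -/
lemma lintegral_mixed_norm_le {g : ℝ → ℝ≥0∞} (hg : Measurable g) {r : ℝ} (hr : 0 < r)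
    (M : ℝ≥0∞) (V : ℝ → ℝ → ℝ → ℝ≥0∞)
    (hV : ∀ t₁ t₂ t₃, V t₁ t₂ t₃ ≤ M * (g t₂ * g (2 * t₂ - t₃) * g (t₂ + t₁) ^ (2 : ℝ))) :
    (∫⁻ t₃ : ℝ, ∫⁻ t₂ : ℝ, (∫⁻ t₁ : ℝ, V t₁ t₂ t₃) ^ r) ^ (1 / r) ≤
      M * ((∫⁻ u, g u ^ (2 : ℝ)) * ((∫⁻ u, g u ^ r) * ∫⁻ u, g u ^ r) ^ (1 / r)) := by
  set A := ∫⁻ u, g u ^ (2 : ℝ)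
  set R := ∫⁻ u, g u ^ r
  have h₁ : ∀ t₂ t₃, ∫⁻ t₁, V t₁ t₂ t₃ ≤ (M * A) * (g t₂ * g (2 * t₂ - t₃)) := fun t₂ t₃ => by
    refine (lintegral_mono fun t₁ => hV t₁ t₂ t₃).trans_eq ?_
    rw [lintegral_const_mul _ (by fun_prop), lintegral_const_mul _ (by fun_prop),
      lintegral_add_left_eq_self (fun u => g u ^ (2 : ℝ)) t₂]
    ring
  have h₂ : ∫⁻ t₃ : ℝ, ∫⁻ t₂ : ℝ, (∫⁻ t₁ : ℝ, V t₁ t₂ t₃) ^ r ≤ (M * A) ^ r * (R * R) := by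
    calc ∫⁻ t₃ : ℝ, ∫⁻ t₂ : ℝ, (∫⁻ t₁ : ℝ, V t₁ t₂ t₃) ^ r
        ≤ ∫⁻ t₃ : ℝ, ∫⁻ t₂ : ℝ, (M * A) ^ r * (g t₂ ^ r * g (2 * t₂ - t₃) ^ r) := by
          gcongr with t₃ t₂
          rw [← ENNReal.mul_rpow_of_nonneg _ _ hr.le, ← ENNReal.mul_rpow_of_nonneg _ _ hr.le]
          exact ENNReal.rpow_le_rpow (h₁ t₂ t₃) hr.le
      _ = ∫⁻ t₂ : ℝ, ∫⁻ t₃ : ℝ, (M * A) ^ r * (g t₂ ^ r * g (2 * t₂ - t₃) ^ r) :=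
          lintegral_lintegral_swap (by unfold Function.uncurry; fun_prop)
      _ = ∫⁻ t₂ : ℝ, (M * A) ^ r * (g t₂ ^ r * R) := by
          congr 1 with t₂
          rw [lintegral_const_mul _ (by fun_prop), lintegral_const_mul _ (by fun_prop),
            lintegral_sub_left_eq_self (fun u => g u ^ r) (2 * t₂)]
      _ = _ := by
          rw [lintegral_const_mul _ (by fun_prop), lintegral_mul_const _ (by fun_prop)]
  refine (ENNReal.rpow_le_rpow h₂ (by positivity)).trans_eq ?_
  rw [ENNReal.mul_rpow_of_nonneg _ _ (by positivity), ← ENNReal.rpow_mul,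
    mul_one_div_cancel hr.ne', ENNReal.rpow_one, mul_assoc]

lemma SchwartzMap.exists_coe_eq_odd_part (ψ₁ : SchwartzMap ℝ ℝ) :
    ∃ f : SchwartzMap ℝ ℂ, ⇑f = fun y => ((ψ₁ y - ψ₁ (-y) : ℝ) : ℂ) :=
  ⟨(ψ₁ - SchwartzMap.compCLMOfContinuousLinearEquiv ℝ (ContinuousLinearEquiv.neg ℝ)
    ψ₁).postcompCLM Complex.ofRealCLM, by ext y; simp⟩

/-- the symbol of the trilinear Hilbert transform lies in
`𝓜^{(∞,1,r,r);(∞,∞,∞,1)}` for every `r > 1`. -/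
theorem stmt18 (ψ₁ : SchwartzMap ℝ ℝ)
    (hpos : ∀ y, 0 ≤ ψ₁ y) (hle : ∀ y, ψ₁ y ≤ 1)
    (hsupp : tsupport (⇑ψ₁) ⊆ Set.Ioo 0 1)
    (ψ : ℝ → ℂ) (hψ : ψ = fun y => ((ψ₁ y - ψ₁ (-y) : ℝ) : ℂ))
    (Ψ : ℝ × ℝ × ℝ × ℝ → ℂ)
    (hΨ : Ψ = fun X => ψ X.1 * ψ X.2.2.1 * ψ X.2.2.2 * ψ (X.2.1 - X.2.2.1 - 2 * X.2.2.2))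
    (σTH : ℝ × ℝ × ℝ × ℝ → ℂ)
    (hσTH : σTH = fun X =>
      (Real.pi : ℂ) * Complex.I * (Real.sign (X.2.1 - X.2.2.1 - 2 * X.2.2.2) : ℝ))
    (r : ℝ) (hr : 1 < r) :
    (∫⁻ ν : ℝ, ⨆ ξ₁ : ℝ, ⨆ ξ₂ : ℝ, ⨆ ξ₃ : ℝ,
        (∫⁻ t₃ : ℝ,
          ((∫⁻ t₂ : ℝ,
            (∫⁻ t₁ : ℝ, ⨆ x : ℝ,
              (‖symbSTFT4 Ψ σTH x t₁ t₂ t₃ ξ₁ ξ₂ ξ₃ ν‖₊ : ℝ≥0∞)) ^ r) ^ (r / r))) ^ (1 / r))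
      < ∞ := by
  obtain ⟨f, hψ₀⟩ := ψ₁.exists_coe_eq_odd_part
  rw [← hψ₀] at hψ
  subst hψ hΨ hσTH
  set K : SchwartzMap ℝ ℂ := FourierTransform.fourier f
  obtain ⟨C, hC0, hC⟩ := K.exists_norm_le_mul_inv_pow 4
  obtain ⟨B, hB0, hB⟩ := exists_norm_integral_sign_mul_e2pi_le f
  set g : ℝ → ℝ≥0∞ := fun u => ENNReal.ofReal ((1 + |u|)⁻¹) with hg
  have hgm : Measurable g := by fun_prop
  set D : ℝ := Real.pi * (B * (C * C) * 2) with hD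
  have hD0 : 0 ≤ D := by positivity
  set E : ℝ≥0∞ :=
    (∫⁻ u, g u ^ (2 : ℝ)) * ((∫⁻ u, g u ^ r) * ∫⁻ u, g u ^ r) ^ (1 / r) with hE
  have hEfin : E ≠ ∞ := by
    have hR := (lintegral_inv_one_add_abs_rpow_lt_top hr).ne
    exact ENNReal.mul_ne_top (lintegral_inv_one_add_abs_rpow_lt_top one_lt_two).ne
      (ENNReal.rpow_ne_top_of_nonneg (by positivity) (ENNReal.mul_ne_top hR hR))
  have hbound : ∀ ν ξ₁ ξ₂ ξ₃ t₁ t₂ t₃ x : ℝ,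
      (‖symbSTFT4
        (fun X => f X.1 * f X.2.2.1 * f X.2.2.2 * f (X.2.1 - X.2.2.1 - 2 * X.2.2.2))
        (fun X => (Real.pi : ℂ) * I * (Real.sign (X.2.1 - X.2.2.1 - 2 * X.2.2.2) : ℝ))
        x t₁ t₂ t₃ ξ₁ ξ₂ ξ₃ ν‖₊ : ℝ≥0∞) ≤
      (ENNReal.ofReal D * ‖K ν‖ₑ) *
        (g t₂ * g (2 * t₂ - t₃) * g (t₂ + t₁) ^ (2 : ℝ)) := by
    intro ν ξ₁ ξ₂ ξ₃ t₁ t₂ t₃ x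
    rw [← enorm_eq_nnnorm, ← ofReal_norm, ← ofReal_norm, ← ENNReal.ofReal_mul hD0]
    simp only [hg, ENNReal.rpow_ofNat]
    rw [← ENNReal.ofReal_pow (by positivity), ← ENNReal.ofReal_mul (by positivity),
      ← ENNReal.ofReal_mul (by positivity), ← ENNReal.ofReal_mul (by positivity)]
    refine ENNReal.ofReal_le_ofReal ?_
    rw [norm_symbSTFT4_sign_form]
    simp only [FT1_eq_fourier]
    have h₁ := hC (-(t₁ + t₂))
    have h₂ := hC (-(2 * t₁ + t₃))
    rw [abs_neg] at h₁ h₂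
    calc _ ≤ Real.pi * (‖K ν‖ * ((B * (1 + |t₁|)⁻¹) * ((C * ((1 + |t₁ + t₂|)⁻¹) ^ 4) *
          (C * ((1 + |2 * t₁ + t₃|)⁻¹) ^ 4)))) := by
          gcongr
          exact hB _ t₁
      _ = Real.pi * (B * (C * C)) * ‖K ν‖ * ((1 + |t₁|)⁻¹ * (((1 + |t₁ + t₂|)⁻¹) ^ 4 *
          ((1 + |2 * t₁ + t₃|)⁻¹) ^ 4)) := by ring
      _ ≤ Real.pi * (B * (C * C)) * ‖K ν‖ *
          (2 * ((1 + |t₂|)⁻¹ * (1 + |2 * t₂ - t₃|)⁻¹ * ((1 + |t₂ + t₁|)⁻¹) ^ 2)) := by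
          exact mul_le_mul_of_nonneg_left (inv_one_add_abs_mul_le t₁ t₂ t₃) (by positivity)
      _ = _ := by rw [hD]; ring
  simp only [div_self (show r ≠ 0 by linarith), ENNReal.rpow_one]
  refine lt_of_le_of_lt (lintegral_mono (g := fun ν => ENNReal.ofReal D * ‖K ν‖ₑ * E) fun ν =>
    iSup_le fun ξ₁ => iSup_le fun ξ₂ => iSup_le fun ξ₃ =>
      lintegral_mixed_norm_le hgm (by linarith) _ _ fun t₁ t₂ t₃ => iSup_le fun x =>
        hbound ν ξ₁ ξ₂ ξ₃ t₁ t₂ t₃ x) ?_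
  rw [lintegral_mul_const' _ _ hEfin, lintegral_const_mul' _ _ ENNReal.ofReal_ne_top]
  exact ENNReal.mul_lt_top (ENNReal.mul_lt_top ENNReal.ofReal_lt_top K.integrable.2)
    hEfin.lt_top

end
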